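/- Let u : ℝ² → ℝ be a smooth (C^∞) function and let a : ℝ → ℝ be given by a(x) = 4 for x ≤ 0 and a(x) = 1 for x > 0. Suppose there is a locally integrable function f on ℝ² such that for every smooth compactly supported φ : ℝ² → ℝ one has ∫_{ℝ²} ( a(x) ∂_x u(x,y) ∂_x φ(x,y) + ∂_y u(x,y) ∂_y φ(x,y) ) dx dy = −∫_{ℝ²} φ f dx dy. Then ∂_x u(0,y) = 0 for every y ∈ ℝ. -/

import Mathlib

open MeasureTheory

open Filter Topology

/-- Stretching the first coordinate by `c` divides integrals over the plane by `|c|`. -/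
lemma integral_comp_mul_fst {c : ℝ} (hc : c ≠ 0) (g : ℝ × ℝ → ℝ) :
    ∫ q : ℝ × ℝ, g (c * q.1, q.2) = |c|⁻¹ * ∫ q : ℝ × ℝ, g q := by
  have hmap : Measure.map (Prod.map (c * ·) id) (volume : Measure (ℝ × ℝ)) =
      ENNReal.ofReal |c⁻¹| • (volume : Measure (ℝ × ℝ)) := by
    rw [Measure.volume_eq_prod, ← Measure.map_prod_map _ _ (measurable_const_mul c) measurable_id,
      Real.map_volume_mul_left hc, Measure.map_id, Measure.prod_smul_left]
  have hemb : MeasurableEmbedding (Prod.map (c * ·) id : ℝ × ℝ → ℝ × ℝ) :=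
    ((Homeomorph.mulLeft₀ c hc).prodCongr (Homeomorph.refl ℝ)).measurableEmbedding
  have h := hemb.integral_map (μ := volume) g
  rw [hmap, integral_smul_measure, ENNReal.toReal_ofReal (abs_nonneg _), abs_inv] at h
  simpa [Prod.map] using h.symm

/-- Cutting off to a shrinking strip around the `y`-axis sends integrals to zero. -/
lemma tendsto_integral_shrinking_strip {χ : ℝ → ℝ} (hχ : Continuous χ)
    (hχs : HasCompactSupport χ) {g : ℝ × ℝ → ℝ}
    (hg : LocallyIntegrable g (volume : Measure (ℝ × ℝ))) {K : Set ℝ} (hK : IsCompact K)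
    (hgK : ∀ q : ℝ × ℝ, q.2 ∉ K → g q = 0) :
    Tendsto (fun n : ℕ => ∫ q : ℝ × ℝ, χ ((n + 1 : ℝ) * q.1) * g q) atTop (𝓝 0) := by
  obtain ⟨R, hR⟩ := hχs.isCompact.isBounded.subset_closedBall (0 : ℝ)
  obtain ⟨C, hC⟩ := hχs.exists_bound_of_continuous hχ
  have hzero : ∀ x : ℝ, R < |x| → χ x = 0 := fun x hx => by
    refine image_eq_zero_of_notMem_tsupport fun hx' => ?_
    have := hR hx'
    simp only [mem_closedBall_zero_iff, Real.norm_eq_abs] at this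
    linarith
  set S : Set (ℝ × ℝ) := Metric.closedBall 0 R ×ˢ K
  have hSc : IsCompact S := (isCompact_closedBall _ _).prod hK
  have hbound : Integrable (S.indicator fun q => C * ‖g q‖) volume :=
    IntegrableOn.integrable_indicator ((hg.integrableOn_isCompact hSc).norm.const_mul C)
      hSc.measurableSet
  rw [← integral_zero (ℝ × ℝ) ℝ]
  refine tendsto_integral_of_dominated_convergence _ (fun n => ?_) hbound (fun n => ?_) ?_
  · exact (hχ.comp (by fun_prop)).aestronglyMeasurable.mul hg.aestronglyMeasurable
  · refine Eventually.of_forall fun q => ?_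
    by_cases hq : q ∈ S
    · rw [Set.indicator_of_mem hq, norm_mul]
      exact mul_le_mul_of_nonneg_right (hC _) (norm_nonneg _)
    · rw [Set.indicator_of_notMem hq]
      by_cases hq2 : q.2 ∈ K
      · have h1 : R < |q.1| := by
          by_contra! h
          exact hq ⟨by simpa using h, hq2⟩
        have h2 : |q.1| ≤ |(n + 1 : ℝ) * q.1| := by
          rw [abs_mul, abs_of_nonneg (by positivity : (0 : ℝ) ≤ n + 1)]
          exact le_mul_of_one_le_left (abs_nonneg _) (by simp)
        simp [hzero _ (h1.trans_le h2)]
      · simp [hgK q hq2]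
  · have hne : ∀ᵐ q : ℝ × ℝ, q.1 ≠ 0 :=
      Measure.quasiMeasurePreserving_fst.ae (Measure.ae_ne volume (0 : ℝ))
    filter_upwards [hne] with q hq
    have hlim : Tendsto (fun n : ℕ => (n + 1 : ℝ) * |q.1|) atTop atTop :=
      (tendsto_atTop_add_const_right _ _ tendsto_natCast_atTop_atTop).atTop_mul_const
        (abs_pos.2 hq)
    refine tendsto_const_nhds.congr' ?_
    filter_upwards [hlim.eventually_gt_atTop R] with n hn
    rw [hzero, zero_mul]
    rwa [abs_mul, abs_of_nonneg (by positivity : (0 : ℝ) ≤ n + 1)]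

/-- Blowing up the first coordinate around the `y`-axis replaces a continuous function by its
trace on the axis. -/
lemma tendsto_integral_trace {h ψ : ℝ → ℝ} (hh : Integrable h) (hhs : HasCompactSupport h)
    (hψ : Continuous ψ) (hψs : HasCompactSupport ψ) {v : ℝ × ℝ → ℝ} (hv : Continuous v) :
    Tendsto (fun n : ℕ => ∫ q : ℝ × ℝ, h q.1 * ψ q.2 * v ((n + 1 : ℝ)⁻¹ * q.1, q.2)) atTop
      (𝓝 ((∫ x, h x) * ∫ y, ψ y * v (0, y))) := by
  obtain ⟨R, hR⟩ := hhs.isCompact.isBounded.subset_closedBall (0 : ℝ)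
  have hSc : IsCompact (Metric.closedBall (0 : ℝ) R ×ˢ tsupport ψ) :=
    (isCompact_closedBall _ _).prod hψs.isCompact
  obtain ⟨C, hC⟩ := hSc.exists_bound_of_continuousOn hv.continuousOn
  have hprod : Integrable (fun q : ℝ × ℝ => h q.1 * ψ q.2) volume :=
    hh.mul_prod (hψ.integrable_of_hasCompactSupport hψs)
  have hlim : (∫ x, h x) * ∫ y, ψ y * v (0, y) = ∫ q : ℝ × ℝ, h q.1 * ψ q.2 * v (0, q.2) := by
    rw [← integral_prod_mul, Measure.volume_eq_prod]
    simp only [mul_assoc]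
  rw [hlim]
  refine tendsto_integral_of_dominated_convergence (fun q => ‖h q.1 * ψ q.2‖ * C)
    (fun n => ?_) (hprod.norm.mul_const C) (fun n => ?_) ?_
  · exact hprod.aestronglyMeasurable.mul (hv.comp (by fun_prop)).aestronglyMeasurable
  · refine Eventually.of_forall fun q => ?_
    rw [norm_mul]
    by_cases h1 : q.1 ∈ tsupport h
    · by_cases h2 : q.2 ∈ tsupport ψ
      · refine mul_le_mul_of_nonneg_left (hC _ ⟨?_, h2⟩) (norm_nonneg _)
        have h3 := hR h1
        simp only [mem_closedBall_zero_iff, Real.norm_eq_abs] at h3 ⊢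
        rw [abs_mul, abs_of_nonneg (by positivity : (0 : ℝ) ≤ (n + 1 : ℝ)⁻¹)]
        exact (mul_le_of_le_one_left (abs_nonneg _) (inv_le_one_of_one_le₀ (by simp))).trans h3
      · simp [image_eq_zero_of_notMem_tsupport h2]
    · simp [image_eq_zero_of_notMem_tsupport h1]
  · refine Eventually.of_forall fun q => Tendsto.const_mul _ ?_
    refine (hv.tendsto _).comp (Tendsto.prodMk_nhds ?_ tendsto_const_nhds)
    simpa [one_div] using (tendsto_one_div_add_atTop_nhds_zero_nat (𝕜 := ℝ)).mul_const q.1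

/-- The derivative of a compactly supported function, weighted by `4` on the left half-line and
`1` on the right one, is integrable with integral `3 χ(0)`. -/
lemma integrable_and_integral_weighted_deriv {χ : ℝ → ℝ} (hχ : ContDiff ℝ 1 χ)
    (hχs : HasCompactSupport χ) :
    Integrable (fun x : ℝ => (if x ≤ 0 then (4 : ℝ) else 1) * deriv χ x) ∧
      ∫ x : ℝ, (if x ≤ 0 then (4 : ℝ) else 1) * deriv χ x = 3 * χ 0 := by
  have hd : Integrable (deriv χ) :=
    (hχ.continuous_deriv le_rfl).integrable_of_hasCompactSupport hχs.deriv
  have heq : (fun x : ℝ => (if x ≤ 0 then (4 : ℝ) else 1) * deriv χ x) =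
      fun x => deriv χ x + (Set.Iic (0 : ℝ)).indicator (fun x => 3 * deriv χ x) x := by
    ext x
    by_cases hx : x ≤ 0
    · simp [hx]; ring
    · simp [hx]
  have hi : Integrable ((Set.Iic (0 : ℝ)).indicator fun x => 3 * deriv χ x) :=
    (hd.const_mul 3).indicator measurableSet_Iic
  rw [heq]
  refine ⟨hd.add hi, ?_⟩
  have hzero : ∫ x, deriv χ x = 0 :=
    integral_eq_zero_of_hasDerivAt_of_integrable
      (fun x => (hχ.differentiable (by simp) x).hasDerivAt) hd
      (hχ.continuous.integrable_of_hasCompactSupport hχs)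
  rw [integral_add hd hi, integral_indicator measurableSet_Iic, integral_const_mul,
    hχs.integral_Iic_deriv_eq hχ, hzero, zero_add]

/-- (Anisotropic Cheeger-structure example of the paper.) If a smooth
`u : ℝ² → ℝ` satisfies the weak formulation
`∫ (a(x) ∂ₓu ∂ₓφ + ∂ᵧu ∂ᵧφ) dx dy = −∫ φ f dx dy` for all smooth compactly supported
`φ`, where `a(x) = 4` for `x ≤ 0` and `a(x) = 1` for `x > 0` and `f` is locally
integrable, then the singular boundary term along the `y`-axis must vanish:
`∂ₓu(0,y) = 0` for every `y`. -/
theorem anisotropic_weak_formulation_forces_vanishing_normal_derivative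
    (u : ℝ × ℝ → ℝ) (hu : ContDiff ℝ (⊤ : ℕ∞) u)
    (f : ℝ × ℝ → ℝ) (hf : LocallyIntegrable f (volume : Measure (ℝ × ℝ)))
    (hweak : ∀ φ : ℝ × ℝ → ℝ, ContDiff ℝ (⊤ : ℕ∞) φ → HasCompactSupport φ →
      (∫ q : ℝ × ℝ,
          ((if q.1 ≤ 0 then (4 : ℝ) else 1) *
              (fderiv ℝ u q (1, 0)) * (fderiv ℝ φ q (1, 0)) +
            (fderiv ℝ u q (0, 1)) * (fderiv ℝ φ q (0, 1)))) =
        -∫ q : ℝ × ℝ, φ q * f q) :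
    ∀ y : ℝ, fderiv ℝ u (0, y) (1, 0) = 0 := by
  set v : ℝ × ℝ → ℝ := fun q => fderiv ℝ u q (1, 0)
  set w : ℝ × ℝ → ℝ := fun q => fderiv ℝ u q (0, 1)
  have hu' : Continuous (fderiv ℝ u) := hu.continuous_fderiv (by simp)
  have hvc : Continuous v := hu'.clm_apply continuous_const
  have hwc : Continuous w := hu'.clm_apply continuous_const
  let χ : ContDiffBump (0 : ℝ) := ⟨1, 2, one_pos, one_lt_two⟩
  have hχ : ContDiff ℝ (⊤ : ℕ∞) χ := χ.contDiff
  have hχs : HasCompactSupport χ := χ.hasCompactSupport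
  have hχ0 : χ 0 = 1 := χ.one_of_mem_closedBall (by simp [χ])
  obtain ⟨h_int, hval⟩ := integrable_and_integral_weighted_deriv (hχ.of_le (by simp)) hχs
  set h : ℝ → ℝ := fun x => (if x ≤ 0 then (4 : ℝ) else 1) * deriv χ x with hh
  have hhs : HasCompactSupport h := hχs.deriv.mul_left
  have key : ∀ ψ : ℝ → ℝ, ContDiff ℝ (⊤ : ℕ∞) ψ → HasCompactSupport ψ →
      ∫ y, ψ y * v (0, y) = 0 := by
    intro ψ hψ hψs
    have hψ' : Continuous (deriv ψ) := hψ.continuous_deriv (by simp)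
    have hφ : ∀ n : ℕ, (∫ q : ℝ × ℝ, h q.1 * ψ q.2 * v ((n + 1 : ℝ)⁻¹ * q.1, q.2)) +
        (∫ q : ℝ × ℝ, χ ((n + 1 : ℝ) * q.1) * (deriv ψ q.2 * w q)) =
        -∫ q : ℝ × ℝ, χ ((n + 1 : ℝ) * q.1) * (ψ q.2 * f q) := by
      intro n
      have hn : (0 : ℝ) < n + 1 := by positivity
      set c : ℝ := n + 1
      have hχc : HasCompactSupport fun x => χ (c * x) :=
        hχs.comp_homeomorph (Homeomorph.mulLeft₀ c hn.ne')
      have hprod : ∀ {α β : ℝ → ℝ}, HasCompactSupport α → HasCompactSupport β →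
          HasCompactSupport fun q : ℝ × ℝ => α q.1 * β q.2 := fun {α β} hα hβ =>
        HasCompactSupport.intro (hα.isCompact.prod hβ.isCompact) fun q hq => by
          by_cases h1 : q.1 ∈ tsupport α
          · rw [image_eq_zero_of_notMem_tsupport (f := β) fun h2 => hq ⟨h1, h2⟩, mul_zero]
          · rw [image_eq_zero_of_notMem_tsupport h1, zero_mul]
      have hder : ∀ q : ℝ × ℝ, HasFDerivAt (fun q : ℝ × ℝ => χ (c * q.1) * ψ q.2)
          (χ (c * q.1) • (deriv ψ q.2 • ContinuousLinearMap.snd ℝ ℝ ℝ) +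
            ψ q.2 • (deriv χ (c * q.1) • (c • ContinuousLinearMap.fst ℝ ℝ ℝ))) q := fun q =>
        (((hχ.differentiable (by simp) _).hasDerivAt).comp_hasFDerivAt q
          (hasFDerivAt_fst.const_mul c)).mul
          (((hψ.differentiable (by simp) _).hasDerivAt).comp_hasFDerivAt q hasFDerivAt_snd)
      have hφ := hweak (fun q => χ (c * q.1) * ψ q.2)
        ((hχ.comp (contDiff_const.mul contDiff_fst)).mul (hψ.comp contDiff_snd))
        (hprod hχc hψs)
      have hpt : ∀ q : ℝ × ℝ, ((if q.1 ≤ 0 then (4 : ℝ) else 1) * v q *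
            (fderiv ℝ (fun q : ℝ × ℝ => χ (c * q.1) * ψ q.2) q (1, 0)) +
            w q * (fderiv ℝ (fun q : ℝ × ℝ => χ (c * q.1) * ψ q.2) q (0, 1))) =
          c * (h (c * q.1) * ψ q.2 * v q) + χ (c * q.1) * (deriv ψ q.2 * w q) := by
        intro q
        have hsign : c * q.1 ≤ 0 ↔ q.1 ≤ 0 := by
          simp [mul_nonpos_iff, hn.le, hn.not_ge]
        rw [(hder q).fderiv]
        simp only [hh, hsign, add_apply, smul_apply,
          ContinuousLinearMap.coe_fst', ContinuousLinearMap.coe_snd', smul_eq_mul]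
        ring
      have hi1 : Integrable (fun q : ℝ × ℝ => c * (h (c * q.1) * ψ q.2 * v q)) := by
        have hP : Integrable (fun q : ℝ × ℝ => h (c * q.1) * ψ q.2) volume :=
          (h_int.comp_mul_left' hn.ne').mul_prod (hψ.continuous.integrable_of_hasCompactSupport hψs)
        have hPs := hprod (hhs.comp_homeomorph (Homeomorph.mulLeft₀ c hn.ne')) hψs
        refine Integrable.const_mul ?_ c
        refine (integrableOn_iff_integrable_of_support_subset ?_).1
          (hP.integrableOn.mul_continuousOn hvc.continuousOn hPs.isCompact)
        exact (Function.support_mul_subset_left _ _).trans (subset_tsupport _)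
      have hi2 : Integrable (fun q : ℝ × ℝ => χ (c * q.1) * (deriv ψ q.2 * w q)) := by
        refine Continuous.integrable_of_hasCompactSupport (by fun_prop) ?_
        simp only [← mul_assoc]
        exact (hprod hχc hψs.deriv).mul_right
      have hscale := integral_comp_mul_fst hn.ne'
        fun q => h q.1 * ψ q.2 * v (c⁻¹ * q.1, q.2)
      simp only [inv_mul_cancel_left₀ hn.ne', abs_of_pos hn] at hscale
      rw [integral_congr_ae (Eventually.of_forall hpt), integral_add hi1 hi2, integral_const_mul,
        hscale, mul_inv_cancel_left₀ hn.ne'] at hφ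
      simpa only [mul_assoc] using hφ
    have l1 := tendsto_integral_trace h_int hhs hψ.continuous hψs hvc
    have l2 := tendsto_integral_shrinking_strip hχ.continuous hχs
      (g := fun q => deriv ψ q.2 * w q)
      (Continuous.locallyIntegrable (by fun_prop)) hψs.deriv.isCompact
      fun q hq => by simp [image_eq_zero_of_notMem_tsupport hq]
    have l3 := tendsto_integral_shrinking_strip hχ.continuous hχs
      (g := fun q => ψ q.2 * f q)
      (hf.continuous_smul (g := fun q : ℝ × ℝ => ψ q.2) (by fun_prop)) hψs.isCompact
      fun q hq => by simp [image_eq_zero_of_notMem_tsupport hq]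
    have := tendsto_nhds_unique ((l1.add l2).congr hφ) l3.neg
    rw [hval, hχ0] at this
    linarith
  have hv0 : Continuous fun y : ℝ => v (0, y) := by fun_prop
  have hae : ∀ᵐ y : ℝ, v (0, y) = 0 :=
    ae_eq_zero_of_integral_contDiff_smul_eq_zero hv0.locallyIntegrable
      fun ψ hψ hψs => key ψ hψ hψs
  exact fun y => congrFun ((hv0.ae_eq_iff_eq volume continuous_const).1 hae) y
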